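/- Let Y be a real Gaussian random variable with mean μ and standard deviation σ > 0, and let c ∈ ℝ. Then the expected improvement E[max(Y − c, 0)] equals (μ − c)·Φ(z) + σ·φ(z), where z = (μ − c)/σ, Φ is the cumulative distribution function of the standard normal distribution, and φ is its probability density function. -/

import Mathlib

open MeasureTheory

/-- The probability density function of the standard normal distribution. -/
noncomputable def stdNormalPDF (z : ℝ) : ℝ :=
  (1 / Real.sqrt (2 * Real.pi)) * Real.exp (-z ^ 2 / 2)

/-- The cumulative distribution function of the standard normal distribution. -/
noncomputable def stdNormalCDF (z : ℝ) : ℝ :=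
  ∫ t in Set.Iic z, stdNormalPDF t

lemma stdNormalPDF_eq_gaussianPDFReal :
    stdNormalPDF = ProbabilityTheory.gaussianPDFReal 0 1 := by
  ext x
  simp [stdNormalPDF, ProbabilityTheory.gaussianPDFReal]

lemma integrable_stdNormalPDF : Integrable stdNormalPDF :=
  stdNormalPDF_eq_gaussianPDFReal ▸ ProbabilityTheory.integrable_gaussianPDFReal 0 1

lemma hasDerivAt_stdNormalPDF (x : ℝ) :
    HasDerivAt stdNormalPDF (-x * stdNormalPDF x) x := by
  unfold stdNormalPDF
  have h : HasDerivAt (fun z : ℝ => -z ^ 2 / 2) (-x) x := by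
    refine ((hasDerivAt_pow 2 x).fun_neg.div_const 2).congr_deriv ?_
    norm_num
    ring
  refine (h.exp.const_mul (1 / Real.sqrt (2 * Real.pi))).congr_deriv ?_
  ring

lemma integrable_neg_mul_stdNormalPDF : Integrable (fun x => -x * stdNormalPDF x) := by
  have h := (integrable_mul_exp_neg_mul_sq (b := 1 / 2) (by norm_num)).const_mul
    (-(1 / Real.sqrt (2 * Real.pi)))
  refine h.congr (.of_forall fun x => ?_)
  simp only [stdNormalPDF]
  rw [show -(1 / 2 : ℝ) * x ^ 2 = -x ^ 2 / 2 by ring]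
  ring

lemma tendsto_stdNormalPDF_atBot :
    Filter.Tendsto stdNormalPDF Filter.atBot (nhds 0) := by
  have h : Filter.Tendsto (fun z : ℝ => z ^ 2 / 2) Filter.atBot Filter.atTop :=
    (by simpa [sq] using Filter.tendsto_id.atBot_mul_atBot₀ Filter.tendsto_id :
      Filter.Tendsto (fun z : ℝ => z ^ 2) Filter.atBot Filter.atTop).atTop_div_const two_pos
  unfold stdNormalPDF
  simpa [Function.comp_def, neg_div] using
    (Real.tendsto_exp_neg_atTop_nhds_zero.comp h).const_mul (1 / Real.sqrt (2 * Real.pi))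

lemma setIntegral_Iic_neg_mul_stdNormalPDF (z : ℝ) :
    ∫ t in Set.Iic z, -t * stdNormalPDF t = stdNormalPDF z := by
  simpa using integral_Iic_of_hasDerivAt_of_tendsto' (a := z)
    (fun x _ => hasDerivAt_stdNormalPDF x)
    integrable_neg_mul_stdNormalPDF.integrableOn tendsto_stdNormalPDF_atBot

lemma integral_max_sub_mul_stdNormalPDF (z : ℝ) :
    ∫ t, stdNormalPDF t * max (z - t) 0 = z * stdNormalCDF z + stdNormalPDF z := by
  have h : (fun t => stdNormalPDF t * max (z - t) 0) =
      (Set.Iic z).indicator fun t => z * stdNormalPDF t + -t * stdNormalPDF t := by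
    ext t
    by_cases ht : t ≤ z
    · rw [Set.indicator_of_mem (Set.mem_Iic.2 ht), max_eq_left (sub_nonneg.2 ht)]
      ring
    · rw [Set.indicator_of_notMem (by simpa using ht),
        max_eq_right (sub_nonpos.2 (not_le.1 ht).le), mul_zero]
  rw [h, integral_indicator measurableSet_Iic,
    integral_add (integrable_stdNormalPDF.const_mul z).integrableOn
      integrable_neg_mul_stdNormalPDF.integrableOn,
    integral_const_mul, setIntegral_Iic_neg_mul_stdNormalPDF, stdNormalCDF]

lemma gaussianReal_eq_map_const_sub_mul (μ σ : ℝ) :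
    ProbabilityTheory.gaussianReal μ (⟨σ ^ 2, sq_nonneg σ⟩ : NNReal) =
      (ProbabilityTheory.gaussianReal 0 1).map (fun t => μ - σ * t) := by
  have h : (fun t : ℝ => μ - σ * t) = (fun t => μ - t) ∘ (fun t => σ * t) := rfl
  rw [h, ← Measure.map_map (by fun_prop) (by fun_prop),
    ProbabilityTheory.gaussianReal_map_const_mul, ProbabilityTheory.gaussianReal_map_const_sub,
    mul_zero, sub_zero, mul_one]
  rfl

/-- **Closed form of the expected improvement.**
If `Y` is Gaussian with mean `μ` and standard deviation `σ > 0`, then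
`E[max(Y − c, 0)] = (μ − c)·Φ(z) + σ·φ(z)` where `z = (μ − c)/σ`. -/
theorem expected_improvement
    {Ω : Type*} [MeasurableSpace Ω]
    (P : Measure Ω) [IsProbabilityMeasure P]
    (Y : Ω → ℝ) (μ σ c : ℝ) (hσ : 0 < σ)
    (hY : Measure.map Y P = ProbabilityTheory.gaussianReal μ (⟨σ ^ 2, sq_nonneg σ⟩ : NNReal)) :
    ∫ ω, max (Y ω - c) 0 ∂P =
      (μ - c) * stdNormalCDF ((μ - c) / σ) + σ * stdNormalPDF ((μ - c) / σ) := by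
  have hYm : AEMeasurable Y P := by
    refine AEMeasurable.of_map_ne_zero ?_
    rw [hY]
    change ProbabilityTheory.gaussianReal μ (NNReal.mk (σ ^ 2) (sq_nonneg σ)) ≠ 0
    exact IsProbabilityMeasure.ne_zero _
  have hscale (t : ℝ) : max (μ - σ * t - c) 0 = σ * max ((μ - c) / σ - t) 0 := by
    rw [mul_max_of_nonneg _ _ hσ.le, mul_zero, mul_sub, mul_div_cancel₀ _ hσ.ne']
    congr 1
    ring
  calc ∫ ω, max (Y ω - c) 0 ∂P
      = ∫ y, max (y - c) 0 ∂(P.map Y) :=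
        (integral_map hYm (f := fun y => max (y - c) 0)
          (by fun_prop)).symm
    _ = ∫ t, max (μ - σ * t - c) 0 ∂(ProbabilityTheory.gaussianReal 0 1) := by
        rw [hY, gaussianReal_eq_map_const_sub_mul,
          integral_map (by fun_prop) (by fun_prop)]
    _ = σ * ∫ t, stdNormalPDF t * max ((μ - c) / σ - t) 0 := by
        simp_rw [hscale]
        rw [integral_const_mul,
          ProbabilityTheory.integral_gaussianReal_eq_integral_smul one_ne_zero,
          stdNormalPDF_eq_gaussianPDFReal]
        simp only [smul_eq_mul]
    _ = _ := by
        rw [integral_max_sub_mul_stdNormalPDF, mul_add, ← mul_assoc, mul_div_cancel₀ _ hσ.ne']
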